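/- Let ℓ ≥ 1 be an integer and α a smooth function on ℝ^{n+2} ∖ {0} homogeneous of degree −ℓ − n/2, i.e. X·∂ α = (−ℓ − n/2) α. Then there exists a smooth function β on ℝ^{n+2} ∖ {0} such that □^{ℓ−1}((X²)^{ℓ−1} α) = r α + X² β, where r = (−4)^{ℓ−1} ((ℓ−1)!)² is a nonzero constant. -/

import Mathlib

noncomputable section

/-- Partial derivative in coordinate direction `A` of a function on `ℝ^m`. -/
def pd {m : ℕ} (A : Fin m) (f : (Fin m → ℝ) → ℝ) : (Fin m → ℝ) → ℝ :=
  fun x => fderiv ℝ f x (Pi.single A 1)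

/-- The Euler operator `X·∂`. -/
def euler {m : ℕ} (f : (Fin m → ℝ) → ℝ) : (Fin m → ℝ) → ℝ :=
  fun x => ∑ A, x A * pd A f x

/-- The Laplacian `□ = η^{AB} ∂_A ∂_B` for the diagonal metric with entries `ε`. -/
def lap {m : ℕ} (ε : Fin m → ℝ) (f : (Fin m → ℝ) → ℝ) : (Fin m → ℝ) → ℝ :=
  fun x => ∑ A, ε A * pd A (pd A f) x

/-- `X² = η_{AB} X^A X^B` for the diagonal metric with entries `ε`. -/
def xsq {m : ℕ} (ε : Fin m → ℝ) (x : Fin m → ℝ) : ℝ :=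
  ∑ A, ε A * x A ^ 2

/-- `ε` is a diagonal metric with all entries `±1` and exactly `q` entries equal to `-1`,
i.e. a nondegenerate symmetric bilinear form of signature `(m - q, q)`. -/
def isSig {m : ℕ} (ε : Fin m → ℝ) (q : ℕ) : Prop :=
  (∀ A, ε A = 1 ∨ ε A = -1) ∧ Nat.card {A : Fin m // ε A = -1} = q

/-- The flat Thomas-D operator `D_A = 2(X·∂ + c)∂_A - X_A □` (with `c = n/2`). -/
def thomasD {m : ℕ} (ε : Fin m → ℝ) (c : ℝ) (A : Fin m) (f : (Fin m → ℝ) → ℝ) :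
    (Fin m → ℝ) → ℝ :=
  fun x => 2 * (euler (pd A f) x + c * pd A f x) - ε A * x A * lap ε f x

/-- Smoothness on the punctured space. -/
def PuncturedSmooth {m : ℕ} (f : (Fin m → ℝ) → ℝ) : Prop :=
  ContDiffOn ℝ (⊤ : ℕ∞) f {x | x ≠ 0}

section Calculus

variable {m : ℕ} {f g : (Fin m → ℝ) → ℝ} {x : Fin m → ℝ}

lemma PuncturedSmooth.contDiffAt (hf : PuncturedSmooth f) (hx : x ≠ 0) :
    ContDiffAt ℝ (⊤ : ℕ∞) f x :=
  ContDiffOn.contDiffAt hf (isOpen_ne.mem_nhds hx)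

lemma PuncturedSmooth.differentiableAt (hf : PuncturedSmooth f) (hx : x ≠ 0) :
    DifferentiableAt ℝ f x :=
  (hf.contDiffAt hx).differentiableAt (by simp)

lemma PuncturedSmooth.add (hf : PuncturedSmooth f) (hg : PuncturedSmooth g) :
    PuncturedSmooth (fun y => f y + g y) :=
  ContDiffOn.add hf hg

lemma PuncturedSmooth.mul (hf : PuncturedSmooth f) (hg : PuncturedSmooth g) :
    PuncturedSmooth (fun y => f y * g y) :=
  ContDiffOn.mul hf hg

lemma PuncturedSmooth.sum {ι : Type*} {s : Finset ι} {F : ι → (Fin m → ℝ) → ℝ}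
    (hF : ∀ i ∈ s, PuncturedSmooth (F i)) : PuncturedSmooth (fun y => ∑ i ∈ s, F i y) :=
  ContDiffOn.sum hF

lemma puncturedSmooth_const (c : ℝ) : PuncturedSmooth (fun _ : Fin m → ℝ => c) :=
  contDiffOn_const

lemma puncturedSmooth_coord (A : Fin m) : PuncturedSmooth (fun y : Fin m → ℝ => y A) :=
  (contDiff_apply ℝ ℝ A).contDiffOn

lemma puncturedSmooth_xsq (ε : Fin m → ℝ) : PuncturedSmooth (xsq ε) := by
  unfold PuncturedSmooth xsq
  fun_prop

lemma PuncturedSmooth.pow (hf : PuncturedSmooth f) (k : ℕ) :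
    PuncturedSmooth (fun y => f y ^ k) :=
  ContDiffOn.pow hf k

lemma PuncturedSmooth.pd (hf : PuncturedSmooth f) (A : Fin m) : PuncturedSmooth (pd A f) :=
  (ContDiffOn.fderiv_of_isOpen hf isOpen_ne (by simp)).clm_apply contDiffOn_const

lemma PuncturedSmooth.lap (hf : PuncturedSmooth f) (ε : Fin m → ℝ) :
    PuncturedSmooth (lap ε f) :=
  PuncturedSmooth.sum fun A _ => (puncturedSmooth_const _).mul ((hf.pd A).pd A)

lemma pd_congr (A : Fin m) (h : ∀ y, y ≠ 0 → f y = g y) (hx : x ≠ 0) : pd A f x = pd A g x := by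
  have : f =ᶠ[nhds x] g := Filter.eventually_of_mem (isOpen_ne.mem_nhds hx) h
  simp only [pd, this.fderiv_eq]

lemma lap_congr (ε : Fin m → ℝ) (h : ∀ y, y ≠ 0 → f y = g y) (hx : x ≠ 0) :
    lap ε f x = lap ε g x :=
  Finset.sum_congr rfl fun A _ => by rw [pd_congr A (fun _ hy => pd_congr A h hy) hx]

lemma lap_iterate_congr (ε : Fin m → ℝ) (j : ℕ) (h : ∀ y, y ≠ 0 → f y = g y) (hx : x ≠ 0) :
    (lap ε)^[j] f x = (lap ε)^[j] g x := by
  induction j generalizing f g with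
  | zero => exact h x hx
  | succ j ih => exact ih fun y hy => lap_congr ε h hy

lemma pd_add (A : Fin m) (hf : PuncturedSmooth f) (hg : PuncturedSmooth g) (hx : x ≠ 0) :
    pd A (fun y => f y + g y) x = pd A f x + pd A g x := by
  simp [pd, fderiv_fun_add (hf.differentiableAt hx) (hg.differentiableAt hx)]

lemma pd_mul (A : Fin m) (hf : PuncturedSmooth f) (hg : PuncturedSmooth g) (hx : x ≠ 0) :
    pd A (fun y => f y * g y) x = f x * pd A g x + g x * pd A f x := by
  simp [pd, fderiv_fun_mul (hf.differentiableAt hx) (hg.differentiableAt hx)]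

lemma pd_sum {ι : Type*} {s : Finset ι} {F : ι → (Fin m → ℝ) → ℝ} (A : Fin m)
    (hF : ∀ i ∈ s, PuncturedSmooth (F i)) (hx : x ≠ 0) :
    pd A (fun y => ∑ i ∈ s, F i y) x = ∑ i ∈ s, pd A (F i) x := by
  simp [pd, fderiv_fun_sum fun i hi => (hF i hi).differentiableAt hx]

lemma pd_const (A : Fin m) (c : ℝ) (x : Fin m → ℝ) : pd A (fun _ => c) x = 0 := by
  simp [pd]

lemma pd_const_mul (A : Fin m) (c : ℝ) (hf : PuncturedSmooth f) (hx : x ≠ 0) :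
    pd A (fun y => c * f y) x = c * pd A f x := by
  rw [pd_mul A (puncturedSmooth_const c) hf hx, pd_const]
  ring

lemma pd_coord (A B : Fin m) (x : Fin m → ℝ) :
    pd A (fun y => y B) x = if B = A then 1 else 0 := by
  simp only [pd]
  rw [(hasFDerivAt_apply B x).fderiv]
  simp [Pi.single_apply]

lemma pd_comm (A B : Fin m) (hf : PuncturedSmooth f) (hx : x ≠ 0) :
    pd A (pd B f) x = pd B (pd A f) x := by
  have hd : DifferentiableAt ℝ (fderiv ℝ f) x :=
    ((hf.contDiffAt hx).fderiv_right (m := 1) (by norm_cast)).differentiableAt (by simp)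
  have hsymm : IsSymmSndFDerivAt ℝ f x :=
    (hf.contDiffAt hx).isSymmSndFDerivAt (by
      rw [minSmoothness_of_isRCLikeNormedField]
      exact WithTop.coe_le_coe.mpr (le_top : (2 : ℕ∞) ≤ ⊤))
  have key : ∀ C D : Fin m, pd C (pd D f) x
      = fderiv ℝ (fderiv ℝ f) x (Pi.single C 1) (Pi.single D 1) := by
    intro C D
    change fderiv ℝ (fun y => fderiv ℝ f y (Pi.single D 1)) x (Pi.single C 1) = _
    rw [fderiv_clm_apply hd (by fun_prop)]
    simp
  rw [key, key]
  exact hsymm _ _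

lemma lap_add (ε : Fin m → ℝ) (hf : PuncturedSmooth f) (hg : PuncturedSmooth g) (hx : x ≠ 0) :
    lap ε (fun y => f y + g y) x = lap ε f x + lap ε g x := by
  simp only [lap, ← Finset.sum_add_distrib]
  refine Finset.sum_congr rfl fun A _ => ?_
  rw [pd_congr A (fun _ hy => pd_add A hf hg hy) hx, pd_add A (hf.pd A) (hg.pd A) hx]
  ring

lemma lap_const_mul (ε : Fin m → ℝ) (c : ℝ) (hf : PuncturedSmooth f) (hx : x ≠ 0) :
    lap ε (fun y => c * f y) x = c * lap ε f x := by
  simp only [lap, Finset.mul_sum]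
  refine Finset.sum_congr rfl fun A _ => ?_
  rw [pd_congr A (fun _ hy => pd_const_mul A c hf hy) hx, pd_const_mul A c (hf.pd A) hx]
  ring

lemma lap_iterate_add_const_mul (ε : Fin m → ℝ) (c : ℝ) (j : ℕ) (hf : PuncturedSmooth f)
    (hg : PuncturedSmooth g) (hx : x ≠ 0) :
    (lap ε)^[j] (fun y => f y + c * g y) x = (lap ε)^[j] f x + c * (lap ε)^[j] g x := by
  induction j generalizing f g with
  | zero => rfl
  | succ j ih =>
    simp only [Function.iterate_succ_apply]
    rw [← ih (hf.lap ε) (hg.lap ε)]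
    refine lap_iterate_congr ε j (fun y hy => ?_) hx
    rw [lap_add ε hf ((puncturedSmooth_const c).mul hg) hy, lap_const_mul ε c hg hy]

lemma pd_xsq (ε : Fin m → ℝ) (A : Fin m) (hx : x ≠ 0) : pd A (xsq ε) x = 2 * ε A * x A := by
  change pd A (fun y => ∑ B, ε B * y B ^ 2) x = _
  have hs : ∀ B : Fin m, PuncturedSmooth (fun y => y B ^ 2) := fun B =>
    (puncturedSmooth_coord B).pow 2
  rw [pd_sum A (fun B _ => (puncturedSmooth_const (ε B)).mul (hs B)) hx,
    Finset.sum_eq_single A]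
  · rw [pd_const_mul A _ (hs A) hx]
    simp only [pow_two]
    rw [pd_mul A (puncturedSmooth_coord A) (puncturedSmooth_coord A) hx, pd_coord]
    simp only [if_true]
    ring
  · intro B _ hBA
    rw [pd_const_mul A _ (hs B) hx]
    simp only [pow_two]
    rw [pd_mul A (puncturedSmooth_coord B) (puncturedSmooth_coord B) hx, pd_coord, if_neg hBA]
    ring
  · simp

/-- The commutator identity `[□, X²] = 4 X·∂ + 2m`. -/
lemma lap_xsq_mul {ε : Fin m → ℝ} (hε : ∀ A, ε A * ε A = 1) (hf : PuncturedSmooth f)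
    (hx : x ≠ 0) :
    lap ε (fun y => xsq ε y * f y) x = xsq ε x * lap ε f x + 4 * euler f x + 2 * m * f x := by
  have hterm : ∀ A, ε A * pd A (pd A (fun y => xsq ε y * f y)) x
      = xsq ε x * (ε A * pd A (pd A f) x) + 4 * (x A * pd A f x) + 2 * f x := by
    intro A
    have h1 : ∀ y, y ≠ 0 → pd A (fun y => xsq ε y * f y) y
        = xsq ε y * pd A f y + (2 * ε A) * (y A * f y) := by
      intro y hy
      rw [pd_mul A (puncturedSmooth_xsq ε) hf hy, pd_xsq ε A hy]
      ring
    have hc := (puncturedSmooth_coord A).mul hf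
    rw [pd_congr A h1 hx, pd_add A ((puncturedSmooth_xsq ε).mul (hf.pd A))
      ((puncturedSmooth_const _).mul hc) hx, pd_mul A (puncturedSmooth_xsq ε) (hf.pd A) hx,
      pd_const_mul A _ hc hx, pd_mul A (puncturedSmooth_coord A) hf hx, pd_xsq ε A hx, pd_coord]
    simp only [if_true]
    linear_combination (4 * x A * pd A f x + 2 * f x) * hε A
  simp only [lap, euler]
  rw [Finset.sum_congr rfl fun A _ => hterm A]
  simp only [Finset.sum_add_distrib, ← Finset.mul_sum, Finset.sum_const, Finset.card_univ,
    Fintype.card_fin, nsmul_eq_mul]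
  ring

lemma euler_mul (hf : PuncturedSmooth f) (hg : PuncturedSmooth g) (hx : x ≠ 0) :
    euler (fun y => f y * g y) x = f x * euler g x + g x * euler f x := by
  simp only [euler, Finset.mul_sum, ← Finset.sum_add_distrib]
  refine Finset.sum_congr rfl fun A _ => ?_
  rw [pd_mul A hf hg hx]
  ring

lemma euler_xsq (ε : Fin m → ℝ) (hx : x ≠ 0) : euler (xsq ε) x = 2 * xsq ε x := by
  simp only [euler, xsq, Finset.mul_sum]
  refine Finset.sum_congr rfl fun A _ => ?_
  rw [pd_xsq ε A hx]
  ring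

lemma pd_euler (A : Fin m) (hf : PuncturedSmooth f) (hx : x ≠ 0) :
    pd A (euler f) x = pd A f x + euler (pd A f) x := by
  change pd A (fun y => ∑ B, y B * pd B f y) x = _
  rw [pd_sum A (fun B _ => (puncturedSmooth_coord B).mul (hf.pd B)) hx]
  have hterm : ∀ B, pd A (fun y => y B * pd B f y) x
      = x B * pd B (pd A f) x + if B = A then pd B f x else 0 := by
    intro B
    rw [pd_mul A (puncturedSmooth_coord B) (hf.pd B) hx, pd_coord, pd_comm A B hf hx]
    simp
  simp only [hterm, Finset.sum_add_distrib, Finset.sum_ite_eq', Finset.mem_univ, if_true, euler]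
  ring

end Calculus

/-- Smooth functions on the punctured space that are homogeneous of degree `w`. -/
structure PuncturedHomogeneous {m : ℕ} (w : ℝ) (f : (Fin m → ℝ) → ℝ) : Prop where
  smooth : PuncturedSmooth f
  euler_eq : ∀ x, x ≠ 0 → euler f x = w * f x

namespace PuncturedHomogeneous

variable {m : ℕ} {w : ℝ} {f : (Fin m → ℝ) → ℝ}

lemma pd (hf : PuncturedHomogeneous w f) (A : Fin m) :
    PuncturedHomogeneous (w - 1) (pd A f) := by
  refine ⟨hf.smooth.pd A, fun x hx => ?_⟩
  have h := pd_congr A hf.euler_eq hx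
  rw [pd_euler A hf.smooth hx, pd_const_mul A w hf.smooth hx] at h
  linear_combination h

lemma lap (hf : PuncturedHomogeneous w f) (ε : Fin m → ℝ) :
    PuncturedHomogeneous (w - 2) (lap ε f) := by
  refine ⟨hf.smooth.lap ε, fun x hx => ?_⟩
  have hs := fun A => (hf.smooth.pd A).pd A
  have hpd : ∀ B, _root_.pd B (_root_.lap ε f) x
      = ∑ A, ε A * _root_.pd B (_root_.pd A (_root_.pd A f)) x := by
    intro B
    change _root_.pd B (fun y => ∑ A, ε A * _root_.pd A (_root_.pd A f) y) x = _
    rw [pd_sum B (fun A _ => (puncturedSmooth_const (ε A)).mul (hs A)) hx]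
    exact Finset.sum_congr rfl fun A _ => pd_const_mul B _ (hs A) hx
  simp only [euler, hpd, _root_.lap, Finset.mul_sum]
  rw [Finset.sum_comm]
  refine Finset.sum_congr rfl fun A _ => ?_
  have h := ((hf.pd A).pd A).euler_eq x hx
  simp only [euler] at h
  calc ∑ B, x B * (ε A * _root_.pd B (_root_.pd A (_root_.pd A f)) x)
      = ε A * ∑ B, x B * _root_.pd B (_root_.pd A (_root_.pd A f)) x := by
        rw [Finset.mul_sum]
        exact Finset.sum_congr rfl fun B _ => by ring
    _ = (w - 2) * (ε A * _root_.pd A (_root_.pd A f) x) := by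
        rw [h]
        ring

lemma xsq_pow_mul (hf : PuncturedHomogeneous w f) (ε : Fin m → ℝ) (k : ℕ) :
    PuncturedHomogeneous (w + 2 * k) (fun y => xsq ε y ^ k * f y) := by
  induction k with
  | zero => simpa using hf
  | succ k ih =>
    have heq : (fun y => xsq ε y ^ (k + 1) * f y) = fun y => xsq ε y * (xsq ε y ^ k * f y) := by
      funext y
      ring
    rw [heq]
    refine ⟨(puncturedSmooth_xsq ε).mul ih.smooth, fun x hx => ?_⟩
    rw [euler_mul (puncturedSmooth_xsq ε) ih.smooth hx, euler_xsq ε hx, ih.euler_eq x hx]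
    push_cast
    ring

lemma lap_xsq_pow_succ_mul (hf : PuncturedHomogeneous w f) {ε : Fin m → ℝ}
    (hε : ∀ A, ε A * ε A = 1) (k : ℕ) {x : Fin m → ℝ} (hx : x ≠ 0) :
    _root_.lap ε (fun y => xsq ε y ^ (k + 1) * f y) x
      = xsq ε x ^ (k + 1) * _root_.lap ε f x
        + 2 * (k + 1) * (2 * w + m + 2 * k) * (xsq ε x ^ k * f x) := by
  have heq : ∀ k : ℕ, (fun y => xsq ε y ^ (k + 1) * f y)
      = fun y => xsq ε y * (xsq ε y ^ k * f y) := by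
    intro k
    funext y
    ring
  have hk := hf.xsq_pow_mul ε k
  rw [heq, lap_xsq_mul hε hk.smooth hx, hk.euler_eq x hx]
  induction k with
  | zero =>
    simp only [pow_zero, one_mul, Nat.cast_zero]
    ring
  | succ k ih =>
    have hk' := hf.xsq_pow_mul ε k
    rw [heq, lap_xsq_mul hε hk'.smooth hx, hk'.euler_eq x hx, ih hk']
    push_cast
    ring

/-- Applying `□^j` to `(X²)^(p + j) f` gives an explicit multiple of `(X²)^p f`
modulo `(X²)^(p + 1)`. -/
lemma exists_lap_iterate_xsq_pow_mul (hf : PuncturedHomogeneous w f) {ε : Fin m → ℝ}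
    (hε : ∀ A, ε A * ε A = 1) (j p : ℕ) :
    ∃ β, PuncturedSmooth β ∧ ∀ x, x ≠ 0 →
      (_root_.lap ε)^[j] (fun y => xsq ε y ^ (p + j) * f y) x
        = (∏ i ∈ Finset.range j,
            (2 * ((p + i : ℕ) + 1) * (2 * w + m + 2 * (p + i : ℕ)) : ℝ)) * (xsq ε x ^ p * f x)
          + xsq ε x ^ (p + 1) * β x := by
  induction j generalizing w f p with
  | zero => exact ⟨fun _ => 0, puncturedSmooth_const 0, fun x _ => by simp⟩
  | succ j ih =>
    obtain ⟨β₁, hβ₁, h₁⟩ := ih (hf.lap ε) (p + 1)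
    obtain ⟨β₂, hβ₂, h₂⟩ := ih hf p
    set c₁ : ℝ := ∏ i ∈ Finset.range j,
      (2 * ((p + 1 + i : ℕ) + 1) * (2 * (w - 2) + m + 2 * (p + 1 + i : ℕ)) : ℝ)
    set c : ℝ := 2 * ((p + j : ℕ) + 1) * (2 * w + m + 2 * (p + j : ℕ)) with hc
    refine ⟨fun y => (c₁ * _root_.lap ε f y + xsq ε y * β₁ y) + c * β₂ y,
      (((puncturedSmooth_const c₁).mul (hf.smooth.lap ε)).add
        ((puncturedSmooth_xsq ε).mul hβ₁)).add ((puncturedSmooth_const c).mul hβ₂),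
      fun x hx => ?_⟩
    have hstep : ∀ y, y ≠ 0 → _root_.lap ε (fun y => xsq ε y ^ (p + (j + 1)) * f y) y
        = xsq ε y ^ (p + 1 + j) * _root_.lap ε f y + c * (xsq ε y ^ (p + j) * f y) := by
      intro y hy
      rw [← add_assoc, hf.lap_xsq_pow_succ_mul hε (p + j) hy, hc, add_right_comm]
    rw [Function.iterate_succ_apply, lap_iterate_congr ε j hstep hx,
      lap_iterate_add_const_mul ε c j ((hf.lap ε).xsq_pow_mul ε _).smooth
        (hf.xsq_pow_mul ε _).smooth hx, h₁ x hx, h₂ x hx, Finset.prod_range_succ, ← hc]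
    ring

end PuncturedHomogeneous

lemma prod_range_neg_four_mul (L : ℕ) :
    ∏ i ∈ Finset.range L, (-4 * (((i : ℝ) + 1) * ((L : ℝ) - i)))
      = (-4) ^ L * (L.factorial : ℝ) ^ 2 := by
  have h₁ : ∏ i ∈ Finset.range L, ((i : ℝ) + 1) = L.factorial := by
    exact_mod_cast Finset.prod_range_add_one_eq_factorial L
  have h₂ : ∏ i ∈ Finset.range L, ((L : ℝ) - i) = L.factorial := by
    rw [← h₁, ← Finset.prod_range_reflect]
    refine Finset.prod_congr rfl fun i hi => ?_
    have hi' := Finset.mem_range.mp hi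
    rw [show L - 1 - i = L - (i + 1) by omega, Nat.cast_sub (by omega)]
    push_cast
    ring
  rw [Finset.prod_mul_distrib, Finset.prod_mul_distrib, h₁, h₂]
  simp [pow_two]

/-- for `α` smooth on `ℝ^{n+2} ∖ {0}` homogeneous of degree `-ℓ - n/2`,
there is a smooth `β` on `ℝ^{n+2} ∖ {0}` with
`□^{ℓ-1}((X²)^{ℓ-1} α) = r α + X² β`, where `r = (-4)^{ℓ-1} ((ℓ-1)!)²` is nonzero. -/
theorem lap_pow_xsq_pow_mod_xsq
    (n : ℕ) (hn : 1 ≤ n) (ε : Fin (n + 2) → ℝ) (hsig : isSig ε 2)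
    (ℓ : ℕ) (hℓ : 1 ≤ ℓ) (α : (Fin (n + 2) → ℝ) → ℝ)
    (hα : ContDiffOn ℝ (⊤ : ℕ∞) α {x | x ≠ 0})
    (hom : ∀ x : Fin (n + 2) → ℝ, x ≠ 0 →
      euler α x = (-(ℓ : ℝ) - (n : ℝ) / 2) * α x) :
    ((-4 : ℝ) ^ (ℓ - 1) * ((ℓ - 1).factorial : ℝ) ^ 2 ≠ 0) ∧
    ∃ β : (Fin (n + 2) → ℝ) → ℝ, ContDiffOn ℝ (⊤ : ℕ∞) β {x | x ≠ 0} ∧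
      ∀ x : Fin (n + 2) → ℝ, x ≠ 0 →
        (lap ε)^[ℓ - 1] (fun y => xsq ε y ^ (ℓ - 1) * α y) x
          = (-4 : ℝ) ^ (ℓ - 1) * ((ℓ - 1).factorial : ℝ) ^ 2 * α x + xsq ε x * β x := by
  refine ⟨by positivity, ?_⟩
  have hε : ∀ A, ε A * ε A = 1 := fun A => by
    rcases hsig.1 A with h | h <;> rw [h] <;> norm_num
  obtain ⟨L, rfl⟩ := Nat.exists_eq_add_of_le' hℓ
  have hα' : PuncturedHomogeneous (-((L + 1 : ℕ) : ℝ) - (n : ℝ) / 2) α := ⟨hα, hom⟩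
  obtain ⟨β, hβ, h⟩ := hα'.exists_lap_iterate_xsq_pow_mul hε L 0
  refine ⟨β, hβ, fun x hx => ?_⟩
  have hx' := h x hx
  simp only [zero_add, pow_zero, one_mul, pow_one] at hx'
  rw [Nat.add_sub_cancel, hx', ← prod_range_neg_four_mul L]
  congr 2
  refine Finset.prod_congr rfl fun i _ => ?_
  push_cast
  ring

end
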